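/- For 1 ≤ m ≤ l < n and r = 2l−2m+2, the polynomial K_q(n,m)·[n−1 l−1]_q − q^{2l−2m+2}·K_q(n,m−1)·[n−1 l]_q equals D_q^{2l−2m+2}(n−1,n−1,m−1,l−1) + q^m·D_q^{2l−2m+1}(n,n−1,m,l−1), and hence has nonnegative coefficients as a polynomial in q. -/

import Mathlib

open Polynomial Finset

/-- The Gaussian polynomial `[n m]_q`, as a polynomial in `ℤ[q]`
(it vanishes when `m > n`).  It is defined by the `q`-Pascal recursion
`[n m]_q = [n-1 m-1]_q + q^m [n-1 m]_q`. -/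
noncomputable def gauss : ℕ → ℕ → Polynomial ℤ
  | _, 0 => 1
  | 0, _ + 1 => 0
  | n + 1, m + 1 => gauss n m + X ^ (m + 1) * gauss n (m + 1)

/-- The `q`-Kaplansky number `K_q(n,m) = ((1-q^(n+m))/(1-q^n))·[n m]_q`,
defined as the polynomial `[n-1 m-1]_q + q^m·[n m]_q`. -/
noncomputable def kap (n : ℕ) : ℕ → Polynomial ℤ
  | 0 => 1
  | m + 1 => gauss (n - 1) m + X ^ (m + 1) * gauss n (m + 1)

/-- The number of ones of a (0,1)-sequence. -/
def numOnes {N : ℕ} (w : Fin N → Bool) : ℕ :=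
  (Finset.univ.filter fun i => w i = true).card

/-- The inversion number of a (0,1)-sequence: the number of pairs `(i,j)`
with `i < j`, `w i = 1` and `w j = 0`. -/
def invW {N : ℕ} (w : Fin N → Bool) : ℕ :=
  ((Finset.univ : Finset (Fin N × Fin N)).filter
    fun p => p.1 < p.2 ∧ w p.1 = true ∧ w p.2 = false).card

/-- The major index of a (0,1)-sequence: the sum of the (1-based) positions `i`
with `w_i > w_(i+1)`. -/
def majW {N : ℕ} (w : Fin N → Bool) : ℕ :=
  ∑ i : Fin N,
    if h : (i : ℕ) + 1 < N then
      (if w i = true ∧ w ⟨(i : ℕ) + 1, h⟩ = false then (i : ℕ) + 1 else 0)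
    else 0

/-- The Gaussian polynomial with an integer lower index, vanishing for negative
lower index. -/
noncomputable def gaussI (n : ℕ) (m : ℤ) : Polynomial ℤ :=
  if 0 ≤ m then gauss n m.toNat else 0

/-- `D_q^r(M,N,m,l) = [M m]_q·[N l]_q - q^r·[M m-1]_q·[N l+1]_q`. -/
noncomputable def Dq (M N : ℕ) (m l : ℤ) (r : ℕ) : Polynomial ℤ :=
  gaussI M m * gaussI N l - X ^ r * (gaussI M (m - 1) * gaussI N (l + 1))

theorem gauss_zero' (n : ℕ) : gauss n 0 = 1 := by cases n <;> simp [gauss]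

theorem gauss_ss (n m : ℕ) :
    gauss (n + 1) (m + 1) = gauss n m + X ^ (m + 1) * gauss n (m + 1) := by
  rw [gauss]

theorem gauss_big (n : ℕ) : ∀ m, n < m → gauss n m = 0 := by
  induction n with
  | zero => intro m h; obtain ⟨k, rfl⟩ := Nat.exists_eq_add_of_lt h; simp [gauss]
  | succ n ih =>
    intro m h
    obtain ⟨k, rfl⟩ : ∃ k, m = k + 1 := ⟨m - 1, by omega⟩
    rw [gauss_ss, ih k (by omega), ih (k + 1) (by omega)]; simp

theorem gauss_ss2 (n : ℕ) : ∀ m j, n = m + j →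
    gauss (n + 1) (m + 1) = gauss n (m + 1) + X ^ j * gauss n m := by
  induction n with
  | zero =>
    intro m j h
    obtain ⟨rfl, rfl⟩ : m = 0 ∧ j = 0 := by omega
    simp [gauss]
  | succ n ih =>
    intro m j h
    rcases m with _ | k
    · obtain rfl : j = n + 1 := by omega
      have h1 := ih 0 n (by omega)
      have h2 := gauss_ss n 0
      have h3 := gauss_ss (n + 1) 0
      simp only [gauss_zero', zero_add, pow_one, mul_one] at h1 h2 h3 ⊢
      rw [h3]
      linear_combination X * h1 - h2
    · rcases j with _ | j
      · rw [gauss_ss, gauss_big (n + 1) (k + 1 + 1) (by omega)]; simp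
      · have h1 := ih k (j + 1) (by omega)
        have h2 := ih (k + 1) j (by omega)
        have h3 := gauss_ss n k
        have h4 := gauss_ss n (k + 1)
        have h5 := gauss_ss (n + 1) (k + 1)
        rw [h5]
        linear_combination h1 + X ^ (k + 2) * h2 - h4 - X ^ (j + 1) * h3

/-- Nonnegative coefficients. -/
def NN (p : Polynomial ℤ) : Prop := ∀ i, 0 ≤ p.coeff i

theorem NN.add' {p q : Polynomial ℤ} (hp : NN p) (hq : NN q) : NN (p + q) := by
  intro i; rw [coeff_add]; exact add_nonneg (hp i) (hq i)

theorem NN.mul' {p q : Polynomial ℤ} (hp : NN p) (hq : NN q) : NN (p * q) := by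
  intro i; rw [coeff_mul]; exact Finset.sum_nonneg fun x _ => mul_nonneg (hp _) (hq _)

theorem NN_X (k : ℕ) : NN (X ^ k) := by
  intro i; rw [coeff_X_pow]; split_ifs <;> simp

theorem NN_gauss (n : ℕ) : ∀ m, NN (gauss n m) := by
  induction n with
  | zero =>
    intro m; cases m with
    | zero => rw [gauss_zero']; simpa using NN_X 0
    | succ m => intro i; simp [gauss]
  | succ n ih =>
    intro m; cases m with
    | zero => rw [gauss_zero']; simpa using NN_X 0
    | succ m => rw [gauss_ss]; exact (ih _).add' ((NN_X _).mul' (ih _))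

theorem NN_key (s : ℕ) : ∀ M N a b r, M + N ≤ s → a ≤ b → N + a ≤ M + b →
    r + N + 2 * a ≤ M + 2 * b →
    NN (gauss M (a + 1) * gauss N b - X ^ r * (gauss M a * gauss N (b + 1))) := by
  induction s with
  | zero =>
    intro M N a b r hs h1 h2 h3
    rw [gauss_big N (b + 1) (by omega)]
    simpa using (NN_gauss M (a + 1)).mul' (NN_gauss N b)
  | succ s ih =>
    intro M N a b r hs h1 h2 h3
    by_cases hb : N ≤ b
    · rw [gauss_big N (b + 1) (by omega)]
      simpa using (NN_gauss M (a + 1)).mul' (NN_gauss N b)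
    obtain ⟨N, rfl⟩ : ∃ k, N = k + 1 := ⟨N - 1, by omega⟩
    obtain ⟨M, rfl⟩ : ∃ k, M = k + 1 := ⟨M - 1, by omega⟩
    by_cases hB : N + 1 + a < M + 1 + b
    · -- step in M
      rcases r with _ | r
      · -- second recursion
        obtain ⟨j, hj⟩ : ∃ j, M = a + j := ⟨M - a, by omega⟩
        have e1 := gauss_ss2 M a j hj
        have i1 := ih M (N + 1) a b 0 (by omega) h1 (by omega) (by omega)
        rcases a with _ | a
        · rw [gauss_zero'] at *
          have := i1.add' ((NN_X j).mul' (NN_gauss (N + 1) b))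
          convert this using 1
          rw [e1]; ring
        · have e2 := gauss_ss2 M a (j + 1) (by omega)
          have i2 := ih M (N + 1) a b 1 (by omega) (by omega) (by omega) (by omega)
          have := i1.add' ((NN_X j).mul' i2)
          convert this using 1
          rw [e1, e2]; ring
      · have e1 := gauss_ss M a
        have i1 := ih M (N + 1) a b r (by omega) h1 (by omega) (by omega)
        rcases a with _ | a
        · rw [gauss_zero'] at *
          have := ((NN_X 1).mul' i1).add' (NN_gauss (N + 1) b)
          convert this using 1
          rw [e1]; ring
        · have e2 := gauss_ss M a
          have i2 := ih M (N + 1) a b (r + 1) (by omega) (by omega) (by omega) (by omega)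
          have := ((NN_X (a + 2)).mul' i1).add' i2
          convert this using 1
          rw [e1, e2]; ring
    · by_cases hA : a = b
      · obtain rfl : M = N := by omega
        obtain rfl : r = 0 := by omega
        subst hA
        intro i
        rw [pow_zero, one_mul, mul_comm, sub_self]; simp
      · obtain ⟨b, rfl⟩ : ∃ k, b = k + 1 := ⟨b - 1, by omega⟩
        rcases r with _ | r
        · have e1 := gauss_ss N b
          have e2 := gauss_ss N (b + 1)
          have i1 := ih (M + 1) N a b 0 (by omega) (by omega) (by omega) (by omega)
          have i2 := ih (M + 1) N a (b + 1) 1 (by omega) (by omega) (by omega) (by omega)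
          have := i1.add' ((NN_X (b + 1)).mul' i2)
          convert this using 1
          rw [e1, e2]; ring
        · obtain ⟨j, hj⟩ : ∃ j, N = b + 1 + j := ⟨N - (b + 1), by omega⟩
          have e1 := gauss_ss2 N b (j + 1) (by omega)
          have e2 := gauss_ss2 N (b + 1) j hj
          have i1 := ih (M + 1) N a b r (by omega) (by omega) (by omega) (by omega)
          have i2 := ih (M + 1) N a (b + 1) (r + 1) (by omega) (by omega) (by omega) (by omega)
          have := ((NN_X (j + 1)).mul' i1).add' i2
          convert this using 1
          rw [e1, e2]; ring

theorem gaussI_nat (n m : ℕ) (z : ℤ) (h : z = m) : gaussI n z = gauss n m := by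
  subst h; simp [gaussI]

theorem gaussI_neg (n : ℕ) (z : ℤ) (h : z < 0) : gaussI n z = 0 := by
  simp [gaussI, not_le.mpr h]

/-- For `1 ≤ m ≤ l < n` and `r = 2l - 2m + 2`, the polynomial
`K_q(n,m)·[n-1 l-1]_q - q^(2l-2m+2)·K_q(n,m-1)·[n-1 l]_q` equals
`D_q^(2l-2m+2)(n-1,n-1,m-1,l-1) + q^m·D_q^(2l-2m+1)(n,n-1,m,l-1)`, and hence has
nonnegative coefficients. -/
theorem kaplansky_gauss_difference (n m l : ℕ)
    (hm : 1 ≤ m) (hml : m ≤ l) (hln : l < n) :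
    kap n m * gauss (n - 1) (l - 1) -
        X ^ (2 * l - 2 * m + 2) * (kap n (m - 1) * gauss (n - 1) l) =
      Dq (n - 1) (n - 1) ((m : ℤ) - 1) ((l : ℤ) - 1) (2 * l - 2 * m + 2) +
        X ^ m * Dq n (n - 1) (m : ℤ) ((l : ℤ) - 1) (2 * l - 2 * m + 1) ∧
    ∀ i, 0 ≤ (kap n m * gauss (n - 1) (l - 1) -
      X ^ (2 * l - 2 * m + 2) * (kap n (m - 1) * gauss (n - 1) l)).coeff i := by
  have key : kap n m * gauss (n - 1) (l - 1) -
        X ^ (2 * l - 2 * m + 2) * (kap n (m - 1) * gauss (n - 1) l) =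
      Dq (n - 1) (n - 1) ((m : ℤ) - 1) ((l : ℤ) - 1) (2 * l - 2 * m + 2) +
        X ^ m * Dq n (n - 1) (m : ℤ) ((l : ℤ) - 1) (2 * l - 2 * m + 1) := by
    obtain ⟨m, rfl⟩ : ∃ k, m = k + 1 := ⟨m - 1, by omega⟩
    obtain ⟨l, rfl⟩ : ∃ k, l = k + 1 := ⟨l - 1, by omega⟩
    simp only [Dq, Nat.add_sub_cancel]
    rw [gaussI_nat (n - 1) m (((m + 1 : ℕ) : ℤ) - 1) (by push_cast; ring), gaussI_nat (n - 1) l (((l + 1 : ℕ) : ℤ) - 1) (by push_cast; ring),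
      gaussI_nat (n - 1) (l + 1) (((l + 1 : ℕ) : ℤ) - 1 + 1) (by push_cast; ring), gaussI_nat n (m + 1) _ rfl,
      gaussI_nat n m (((m + 1 : ℕ) : ℤ) - 1) (by push_cast; ring)]
    rcases m with _ | m
    · rw [gaussI_neg (n - 1) (((0 + 1 : ℕ) : ℤ) - 1 - 1) (by simp)]
      simp only [kap, gauss_zero']
      ring
    · rw [gaussI_nat (n - 1) m (((m + 1 + 1 : ℕ) : ℤ) - 1 - 1) (by push_cast; ring)]
      simp only [kap]
      ring
  refine ⟨key, ?_⟩
  rw [key]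
  change NN _
  refine NN.add' ?_ ((NN_X m).mul' ?_)
  · obtain ⟨m, rfl⟩ : ∃ k, m = k + 1 := ⟨m - 1, by omega⟩
    obtain ⟨l, rfl⟩ : ∃ k, l = k + 1 := ⟨l - 1, by omega⟩
    simp only [Dq]
    rw [gaussI_nat (n - 1) m (((m + 1 : ℕ) : ℤ) - 1) (by push_cast; ring), gaussI_nat (n - 1) l (((l + 1 : ℕ) : ℤ) - 1) (by push_cast; ring),
      gaussI_nat (n - 1) (l + 1) (((l + 1 : ℕ) : ℤ) - 1 + 1) (by push_cast; ring)]
    rcases m with _ | m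
    · rw [gaussI_neg (n - 1) (((0 + 1 : ℕ) : ℤ) - 1 - 1) (by simp)]
      simpa using (NN_gauss (n - 1) 0).mul' (NN_gauss (n - 1) l)
    · rw [gaussI_nat (n - 1) m (((m + 1 + 1 : ℕ) : ℤ) - 1 - 1) (by push_cast; ring)]
      exact NN_key _ _ _ _ _ _ le_rfl (by omega) (by omega) (by omega)
  · obtain ⟨m, rfl⟩ : ∃ k, m = k + 1 := ⟨m - 1, by omega⟩
    obtain ⟨l, rfl⟩ : ∃ k, l = k + 1 := ⟨l - 1, by omega⟩
    simp only [Dq]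
    rw [gaussI_nat (n - 1) l (((l + 1 : ℕ) : ℤ) - 1) (by push_cast; ring),
      gaussI_nat (n - 1) (l + 1) (((l + 1 : ℕ) : ℤ) - 1 + 1) (by push_cast; ring), gaussI_nat n (m + 1) _ rfl,
      gaussI_nat n m (((m + 1 : ℕ) : ℤ) - 1) (by push_cast; ring)]
    exact NN_key _ _ _ _ _ _ le_rfl (by omega) (by omega) (by omega)
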